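/- Let m and k be integers with 1 <= k <= m, and let g_{(m,k)} be the function from GF(3)^m to GF(3) taking value 1 on vectors of Hamming weight between 1 and k and value 0 otherwise. Then the Walsh transform of g_{(m,k)} satisfies: g^(0) = 3^m + (zeta_3 - 1) * sum over j from 1 to k of 2^j * binomial(m,j); and for every w in GF(3)^m with Hamming weight i >= 1, g^(w) = (zeta_3 - 1) * (Psi_k(i,m) - 1), where Psi_k is the Lloyd polynomial with q = 3. -/

import Mathlib

/-- The Krawtchouk polynomial `K_t(x,m)` with parameter `q`. -/
def krawtchouk (q t x m : ℕ) : ℤ :=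
  ∑ j ∈ Finset.range (t + 1),
    (-1 : ℤ) ^ j * ((q : ℤ) - 1) ^ (t - j) * (x.choose j) * ((m - x).choose (t - j))

/-- The Lloyd polynomial `Ψ_k(x,m)` with parameter `q`. -/
def lloyd (q k x m : ℕ) : ℤ :=
  ∑ t ∈ Finset.range (k + 1), krawtchouk q t x m

/-- The Walsh transform `g^(w) = ∑_x ζ₃^(g(x) - w·x)`. -/
noncomputable def walsh (m : ℕ) (g : (Fin m → ZMod 3) → ZMod 3) (w : Fin m → ZMod 3) : ℂ :=
  ∑ x : Fin m → ZMod 3,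
    Complex.exp (2 * Real.pi * Complex.I / 3) ^ (g x - ∑ i, w i * x i).val

/-- `g_{(m,k)} : GF(3)^m → GF(3)` takes value `1` on the vectors of Hamming
weight between `1` and `k`, and `0` otherwise. -/
def gmk (m k : ℕ) : (Fin m → ZMod 3) → ZMod 3 :=
  fun x => if 1 ≤ hammingNorm x ∧ hammingNorm x ≤ k then 1 else 0

open Polynomial in
/-- The generating function, by Hamming weight, of the character values `χ (-(w · x))`. -/
theorem sum_X_pow_hammingNorm_mul_addChar (m : ℕ) (χ : AddChar (ZMod 3) ℂ) (hχ : χ ≠ 0)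
    (w : Fin m → ZMod 3) :
    ∑ x : Fin m → ZMod 3, (X : ℂ[X]) ^ hammingNorm x * C (χ (-∑ i, w i * x i))
      = (1 - X) ^ hammingNorm w * (1 + 2 * X) ^ (m - hammingNorm w) := by
  have hprim : ∑ a, χ a = 0 := AddChar.sum_eq_zero_iff_ne_zero.2 hχ
  have hunivs : (Finset.univ : Finset (ZMod 3)) = {0, 1, 2} := by decide
  have h12 : χ 1 + χ 2 = -1 := by
    rw [hunivs] at hprim
    rw [Finset.sum_insert (by decide), Finset.sum_insert (by decide), Finset.sum_singleton,
      AddChar.map_zero_eq_one] at hprim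
    linear_combination hprim
  have hC : (C (χ 1) + C (χ 2) : ℂ[X]) = -1 := by
    rw [← C_add, h12]; simp
  have hlocal (b : ZMod 3) :
      ∑ a : ZMod 3, (if a ≠ 0 then (X : ℂ[X]) else 1) * C (χ (-(b * a)))
        = if b ≠ 0 then 1 - X else 1 + 2 * X := by
    rw [hunivs, Finset.sum_insert (by decide), Finset.sum_insert (by decide),
      Finset.sum_singleton, if_neg (by decide), if_pos (by decide), if_pos (by decide)]
    have hb : b = 0 ∨ b = 1 ∨ b = 2 := by revert b; decide
    rcases hb with rfl | rfl | rfl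
    · simp; ring
    · rw [if_pos (by decide), show (-(1 * 1) : ZMod 3) = 2 by decide,
        show (-(1 * 2) : ZMod 3) = 1 by decide]
      simp
      linear_combination X * hC
    · rw [if_pos (by decide), show (-(2 * 1) : ZMod 3) = 1 by decide,
        show (-(2 * 2) : ZMod 3) = 2 by decide]
      simp
      linear_combination X * hC
  calc
    _ = ∑ x : Fin m → ZMod 3,
          ∏ i, (if x i ≠ 0 then (X : ℂ[X]) else 1) * C (χ (-(w i * x i))) := by
        refine Finset.sum_congr rfl fun x _ => ?_
        have hprod : χ (-∑ i, w i * x i) = ∏ i, χ (-(w i * x i)) := by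
          rw [← Finset.sum_neg_distrib]
          exact map_prod χ.toMonoidHom (fun i => Multiplicative.ofAdd (-(w i * x i))) _
        rw [Finset.prod_mul_distrib, ← map_prod, ← hprod, Finset.prod_ite, Finset.prod_const, Finset.prod_const_one,
          mul_one, hammingNorm]
    _ = ∏ i, if w i ≠ 0 then (1 - X : ℂ[X]) else 1 + 2 * X := by
        rw [← Fintype.prod_sum fun i a =>
          (if a ≠ 0 then (X : ℂ[X]) else 1) * C (χ (-(w i * a)))]
        exact Finset.prod_congr rfl fun i _ => hlocal (w i)
    _ = _ := by
        rw [Finset.prod_ite, Finset.prod_const, Finset.prod_const, hammingNorm,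
          ← Finset.compl_filter (fun i => w i ≠ 0), Finset.card_compl, Fintype.card_fin]

open Polynomial in
theorem coeff_one_add_C_mul_X_pow (a : ℂ) (n t : ℕ) :
    ((1 + C a * X : ℂ[X]) ^ n).coeff t = a ^ t * n.choose t := by
  have h : (1 + C a * X : ℂ[X]) ^ n = ((1 + X) ^ n : ℂ[X]).comp (C a * X) := by simp
  rw [h, comp_C_mul_X_coeff, coeff_one_add_X_pow, mul_comm]

open Polynomial in
theorem coeff_eq_krawtchouk (m t i : ℕ) :
    ((1 - X : ℂ[X]) ^ i * (1 + 2 * X) ^ (m - i)).coeff t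
      = (krawtchouk 3 t i m : ℂ) := by
  have h1 : (1 - X : ℂ[X]) = 1 + C (-1) * X := by simp [sub_eq_add_neg]
  have h2 : (1 + 2 * X : ℂ[X]) = 1 + C 2 * X := by rw [C_ofNat]
  rw [h1, h2, coeff_mul, Finset.Nat.sum_antidiagonal_eq_sum_range_succ_mk, krawtchouk]
  push_cast
  refine Finset.sum_congr rfl fun j _ => ?_
  rw [coeff_one_add_C_mul_X_pow, coeff_one_add_C_mul_X_pow]
  ring

open Polynomial in
theorem walsh_gmk (m k : ℕ) (w : Fin m → ZMod 3) :
    walsh m (gmk m k) w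
      = 0 ^ hammingNorm w * 3 ^ (m - hammingNorm w)
        + (Complex.exp (2 * Real.pi * Complex.I / 3) - 1) *
            ∑ t ∈ Finset.Icc 1 k, (krawtchouk 3 t (hammingNorm w) m : ℂ) := by
  have hprim : IsPrimitiveRoot (Complex.exp (2 * Real.pi * Complex.I / 3)) 3 := by
    simpa using Complex.isPrimitiveRoot_exp 3 (by norm_num)
  rw [walsh]
  set ζ := Complex.exp (2 * Real.pi * Complex.I / 3)
  set χ : AddChar (ZMod 3) ℂ := AddChar.zmodChar 3 hprim.pow_eq_one
  have hχ_apply (a : ZMod 3) : χ a = ζ ^ a.val := AddChar.zmodChar_apply _ a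
  have hχ_one : χ 1 = ζ := by rw [hχ_apply, ZMod.val_one, pow_one]
  have hχ : χ ≠ 0 := by
    intro h
    rw [h, AddChar.zero_apply] at hχ_one
    exact hprim.ne_one (by norm_num) hχ_one.symm
  have hgen := sum_X_pow_hammingNorm_mul_addChar m χ hχ w
  have hone : ∑ x : Fin m → ZMod 3, χ (-∑ i, w i * x i)
      = 0 ^ hammingNorm w * 3 ^ (m - hammingNorm w) := by
    have h := congrArg (eval 1) hgen
    norm_num [eval_finsetSum] at h
    simpa using h
  have hcoeff (t : ℕ) : ∑ x : Fin m → ZMod 3,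
      (if t = hammingNorm x then χ (-∑ i, w i * x i) else 0)
        = krawtchouk 3 t (hammingNorm w) m := by
    have h := congrArg (coeff · t) hgen
    simp only [finsetSum_coeff, coeff_mul_C, coeff_X_pow, coeff_eq_krawtchouk, ite_mul,
      one_mul, zero_mul] at h
    exact h
  simp_rw [← hcoeff]
  rw [Finset.sum_comm, ← hone, Finset.mul_sum, ← Finset.sum_add_distrib]
  refine Finset.sum_congr rfl fun x _ => ?_
  rw [← hχ_apply, sub_eq_add_neg, AddChar.map_add_eq_mul, Finset.sum_ite_eq', gmk]
  simp only [Finset.mem_Icc]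
  split_ifs
  · rw [hχ_one]; ring
  · rw [AddChar.map_zero_eq_one]; ring

theorem krawtchouk_zero_weight (t m : ℕ) : krawtchouk 3 t 0 m = 2 ^ t * m.choose t := by
  rw [krawtchouk, Finset.sum_range_succ']
  simp

theorem krawtchouk_zero_degree (i m : ℕ) : krawtchouk 3 0 i m = 1 := by
  simp [krawtchouk]

/-- The Walsh transform of `g_{(m,k)}`:
`g^(0) = 3^m + (ζ₃ - 1)·∑_{j=1}^k 2^j·C(m,j)`, and for `w` of Hamming weight
`i ≥ 1`, `g^(w) = (ζ₃ - 1)·(Ψ_k(i,m) - 1)` (with `q = 3`). -/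
theorem stmt_13 (m k : ℕ) (hk1 : 1 ≤ k) (hk : k ≤ m) :
    walsh m (gmk m k) 0
        = 3 ^ m + (Complex.exp (2 * Real.pi * Complex.I / 3) - 1) *
            ∑ j ∈ Finset.Icc 1 k, (2 : ℂ) ^ j * (m.choose j) ∧
      ∀ w : Fin m → ZMod 3, 1 ≤ hammingNorm w →
        walsh m (gmk m k) w
          = (Complex.exp (2 * Real.pi * Complex.I / 3) - 1) *
              ((lloyd 3 k (hammingNorm w) m : ℂ) - 1) := by
  refine ⟨?_, fun w hw => ?_⟩
  · simp [walsh_gmk, krawtchouk_zero_weight]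
  · rw [walsh_gmk, zero_pow (by omega), zero_mul, zero_add, lloyd, Finset.range_eq_Ico,
      Finset.sum_eq_sum_Ico_succ_bot (by omega), krawtchouk_zero_degree,
      ← Finset.Ico_add_one_right_eq_Icc]
    push_cast
    rw [add_sub_cancel_left]
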